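/- Let n ≥ 3 and let k be a nonnegative integer such that d = n+k+1 divides p = (k+1)n + k(k+1)/2, and set q = p/d. Then T_{n-1} + T_q is a triangular number; indeed 8(T_{n-1} + T_q) + 1 = ((2n^2 + 2kn + k^2 + n + 2k + 1)/d)^2, where 2n^2 + 2kn + k^2 + n + 2k + 1 = (2n+2k+1)d - 2p is divisible by d. -/

import Mathlib

/-- The triangular number `T m = m(m+1)/2`. -/
def T (m : ℕ) : ℕ := m * (m + 1) / 2

theorem two_mul_T (m : ℕ) : 2 * T m = m * (m + 1) :=
  Nat.mul_div_cancel' (Nat.even_mul_succ_self m).two_dvd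

/-- Let `n ≥ 3`, let `k ≥ 0` with `d = n+k+1` dividing
`p = (k+1)n + k(k+1)/2`, and set `q = p/d`. Then `T (n-1) + T q` is a triangular
number; indeed, with `α = 2n² + 2kn + k² + n + 2k + 1` one has
`α = (2n+2k+1)d - 2p` (stated additively), `d ∣ α`, and
`8(T (n-1) + T q) + 1 = (α/d)²`. -/
theorem quotient_gives_triangular (n k d p q α : ℕ) (hn : 3 ≤ n)
    (hd : d = n + k + 1) (hp : p = (k + 1) * n + k * (k + 1) / 2)
    (hdvd : d ∣ p) (hq : q = p / d)
    (hα : α = 2 * n ^ 2 + 2 * k * n + k ^ 2 + n + 2 * k + 1) :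
    α + 2 * p = (2 * n + 2 * k + 1) * d ∧
    d ∣ α ∧
    8 * (T (n - 1) + T q) + 1 = (α / d) ^ 2 ∧
    ∃ m : ℕ, T (n - 1) + T q = T m := by
  have hp2 : 2 * p = 2 * ((k + 1) * n) + k * (k + 1) := by
    rw [hp, mul_add, ← T, two_mul_T]
  have hsum : α + 2 * p = (2 * n + 2 * k + 1) * d := by
    rw [hp2, hα, hd]; ring
  have hpq : p = d * q := by rw [hq, Nat.mul_div_cancel' hdvd]
  have hd0 : 0 < d := by omega
  have hqle : q ≤ n + k := by
    have : d * q ≤ d * (n + k) := by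
      rw [← hpq, hd]; nlinarith [hp2, Nat.zero_le (n * n), Nat.zero_le (n * k)]
    exact Nat.le_of_mul_le_mul_left this hd0
  obtain ⟨m, hm⟩ := Nat.exists_eq_add_of_le hqle
  have hαm : α = d * (2 * m + 1) := by
    have h : 2 * n + 2 * k + 1 = 2 * m + 1 + 2 * q := by omega
    rw [h, hpq] at hsum
    linarith
  have hT : T (n - 1) + T q = T m := by
    obtain ⟨r, rfl⟩ : ∃ r, n = r + 1 := ⟨n - 1, by omega⟩
    rw [Nat.add_sub_cancel]
    have hr := two_mul_T r
    have hq2 := two_mul_T q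
    have hm2 := two_mul_T m
    have key : r * (r + 1) + q * (q + 1) = m * (m + 1) := by
      rw [hpq, hd] at hp2
      zify at hm hp2 ⊢
      have hm' : (m : ℤ) = r + 1 + k - q := by linarith
      rw [hm']
      linarith
    omega
  refine ⟨hsum, ⟨_, hαm⟩, ?_, m, hT⟩
  rw [hT, hαm, Nat.mul_div_cancel_left _ hd0]
  linarith [two_mul_T m]
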